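/- Let σ = (σ_0, ..., σ_n) be a changemaker with σ_0 = 1 and σ_i = 2 for all i ≥ 2 (i.e., the case k = 2: σ = (1, 1, 2, ..., 2)). Then the orthogonal complement of σ in −ℤ^{n+1} decomposes as an orthogonal direct sum of two nonzero sublattices; in particular it is not isomorphic to any linear lattice Λ(p,q) (whose Gram matrix is an irreducible tridiagonal matrix). -/

import Mathlib

/-- The tridiagonal matrix with diagonal `d` and sub/super-diagonal entries `1`. -/
def triM (n : ℕ) (d : Fin n → ℤ) : Matrix (Fin n) (Fin n) ℤ :=
  fun i j => if i = j then d i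
    else if (i : ℤ) - (j : ℤ) = 1 ∨ (j : ℤ) - (i : ℤ) = 1 then 1 else 0

/-- The orthogonal complement of `σ` in `-ℤ^(n+1)`: all vectors pairing to `0` with `σ`. -/
def orthComp (n : ℕ) (σ : Fin (n + 1) → ℤ) : Submodule ℤ (Fin (n + 1) → ℤ) :=
  LinearMap.ker (∑ i, σ i • (LinearMap.proj i : (Fin (n + 1) → ℤ) →ₗ[ℤ] ℤ))

lemma key_ident (D C : ℕ → ℤ) (h0 : C 0 = 0) (m : ℕ) :
    ∑ k ∈ Finset.range m, C (k+1) * (D k * C (k+1) - C k - C (k+2))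
      = ∑ k ∈ Finset.range m, (D k - 2) * C (k+1)^2
        + ∑ k ∈ Finset.range m, (C (k+1) - C k)^2 + C m ^ 2 - C m * C (m+1) := by
  induction m with
  | zero => simp [h0]
  | succ m ih =>
    rw [Finset.sum_range_succ, Finset.sum_range_succ, Finset.sum_range_succ, ih]
    ring

lemma key (m : ℕ) (C D : ℕ → ℤ) (h0 : C 0 = 0) (hm : C (m+1) = 0)
    (hD : ∀ k < m, 2 ≤ D k)
    (hev : ∀ k < m, Even (D k * C (k+1) - C k - C (k+2)))
    (hQ : ∑ k ∈ Finset.range m, C (k+1) * (D k * C (k+1) - C k - C (k+2)) = 2) : m = 1 := by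
  have hS := key_ident D C h0 m
  rw [hQ] at hS
  have hS' : (2 : ℤ) = ∑ k ∈ Finset.range m, (D k - 2) * C (k+1)^2
        + ∑ k ∈ Finset.range (m+1), (C (k+1) - C k)^2 := by
    rw [Finset.sum_range_succ]; rw [hm] at hS ⊢; linarith
  have hnn : ∀ k ∈ Finset.range m, 0 ≤ (D k - 2) * C (k+1)^2 := by
    intro k hk
    have := hD k (Finset.mem_range.1 hk)
    exact mul_nonneg (by linarith) (sq_nonneg _)
  have hS1 := Finset.sum_nonneg hnn
  have hm0 : m ≠ 0 := by
    rintro rfl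
    simp at hQ
  by_contra hm1
  have h2 : 2 ≤ m := by omega
  by_cases hC1 : Even (C 1)
  · have hall : ∀ k ≤ m, Even (C k) ∧ Even (C (k+1)) := by
      intro k
      induction k with
      | zero => intro _; simp [h0, hC1]
      | succ k ih =>
        intro hk
        obtain ⟨a, b⟩ := ih (by omega)
        refine ⟨b, ?_⟩
        have e := hev k (by omega)
        have : C (k+1+1) = D k * C (k+1) - C k - (D k * C (k+1) - C k - C (k+2)) := by ring
        rw [this]
        exact ((b.mul_left _).sub a).sub e
    have hdiff : ∀ k ≤ m, C (k+1) = C k := by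
      intro k hk
      by_contra hne
      have hle : (C (k+1) - C k)^2 ≤ ∑ k ∈ Finset.range (m+1), (C (k+1) - C k)^2 :=
        Finset.single_le_sum (f := fun k => (C (k+1) - C k)^2)
          (fun i _ => sq_nonneg _) (Finset.mem_range.2 (by omega))
      obtain ⟨t, ht⟩ := (hall k hk).2.sub (hall k hk).1
      have ht0 : t ≠ 0 := by rintro rfl; apply hne; linarith
      have : 1 ≤ t^2 := by have := sq_pos_of_ne_zero ht0; linarith
      rw [ht] at hle
      nlinarith
    have hz : ∀ k ≤ m + 1, C k = 0 := by
      intro k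
      induction k with
      | zero => intro _; exact h0
      | succ k ih => intro hk; rw [hdiff k (by omega), ih (by omega)]
    have : ∑ k ∈ Finset.range m, C (k+1) * (D k * C (k+1) - C k - C (k+2)) = 0 := by
      apply Finset.sum_eq_zero
      intro k hk
      rw [hz (k+1) (by have := Finset.mem_range.1 hk; omega)]; ring
    omega
  · have hCm : ¬ Even (C m) := by
      intro hCm
      have hall : ∀ k ≤ m, Even (C (m - k)) ∧ Even (C (m - k + 1)) := by
        intro k
        induction k with
        | zero => intro _; simp [hm, hCm]
        | succ k ih =>
          intro hk
          obtain ⟨a, b⟩ := ih (by omega)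
          obtain ⟨j, hj⟩ : ∃ j, m - k = j + 1 := ⟨m - k - 1, by omega⟩
          have hj' : m - (k+1) = j := by omega
          rw [hj] at a b
          rw [hj']
          refine ⟨?_, a⟩
          have e := hev j (by omega)
          have : C j = D j * C (j+1) - C (j+2) - (D j * C (j+1) - C j - C (j+2)) := by ring
          rw [this]
          exact ((a.mul_left _).sub b).sub e
      have := (hall m le_rfl).2
      simp at this
      exact hC1 (by simpa using this)
    have p1 : 1 ≤ C 1 ^ 2 := by
      have : C 1 ≠ 0 := by intro h; rw [h] at hC1; simp at hC1
      have := sq_pos_of_ne_zero this; linarith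
    have pm : 1 ≤ C m ^ 2 := by
      have : C m ≠ 0 := by intro h; rw [h] at hCm; simp at hCm
      have := sq_pos_of_ne_zero this; linarith
    have hsub : ∑ k ∈ ({0, 1, m} : Finset ℕ), (C (k+1) - C k)^2
        ≤ ∑ k ∈ Finset.range (m+1), (C (k+1) - C k)^2 := by
      apply Finset.sum_le_sum_of_subset_of_nonneg
      · intro x hx
        simp at hx
        simp; omega
      · intro i _ _; exact sq_nonneg _
    rw [Finset.sum_insert (by simp; omega), Finset.sum_insert (by simp; omega),
      Finset.sum_singleton, hm, h0] at hsub
    simp only [zero_add, sub_zero, zero_sub, neg_sq] at hsub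
    have h21 : C 2 = C 1 := by
      by_contra hne
      have := sq_pos_of_ne_zero (sub_ne_zero.2 hne)
      norm_num at hsub
      linarith
    have e := hev 0 (by omega)
    simp only [zero_add, h0, h21, sub_zero] at e
    have hD0 : 3 ≤ D 0 := by
      have := hD 0 (by omega)
      by_contra hlt
      have h : D 0 = 2 := by omega
      rw [h] at e
      apply hC1
      have : 2 * C 1 - C 1 = C 1 := by ring
      rwa [this] at e
    have hle := Finset.single_le_sum hnn (Finset.mem_range.2 (show 0 < m by omega))
    simp only [zero_add] at hle
    have := sq_nonneg (C (1+1) - C 1)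
    nlinarith

lemma mem_orth (n : ℕ) (σ x : Fin (n + 1) → ℤ) :
    x ∈ orthComp n σ ↔ ∑ i, σ i * x i = 0 := by
  simp [orthComp, LinearMap.mem_ker]

lemma sum_split (n : ℕ) (f : Fin (n+2+1) → ℤ) :
    ∑ i, f i = f 0 + (f 1 + ∑ i : Fin (n+1), f i.succ.succ) := by
  rw [Fin.sum_univ_succ, Fin.sum_univ_succ]; rfl

/-- `e₀ - e₁` -/
def uvec (n : ℕ) : Fin (n+2+1) → ℤ := Fin.cons 1 (Fin.cons (-1) 0)

/-- `e₀ + e₁ - e₂` -/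
def wvec (n : ℕ) : Fin (n+2+1) → ℤ := Fin.cons 1 (Fin.cons 1 (Fin.cons (-1) 0))

lemma uvec0 (n : ℕ) : uvec n 0 = 1 := rfl
lemma uvec1 (n : ℕ) : uvec n 1 = -1 := rfl
lemma uvecs (n : ℕ) (i : Fin (n+1)) : uvec n i.succ.succ = 0 := rfl
lemma wvec0 (n : ℕ) : wvec n 0 = 1 := rfl
lemma wvec1 (n : ℕ) : wvec n 1 = 1 := rfl

lemma mem_orth' (n : ℕ) (σ x : Fin (n + 2 + 1) → ℤ)
    (hσ : ∀ i, σ i = if (i : ℕ) ≤ 1 then 1 else 2) :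
    x ∈ orthComp (n+2) σ ↔ x 0 + (x 1 + 2 * ∑ i : Fin (n+1), x i.succ.succ) = 0 := by
  rw [mem_orth, sum_split, Finset.mul_sum]
  simp [hσ]

lemma u_mem (n : ℕ) (σ : Fin (n + 2 + 1) → ℤ)
    (hσ : ∀ i, σ i = if (i : ℕ) ≤ 1 then 1 else 2) : uvec n ∈ orthComp (n+2) σ := by
  rw [mem_orth' n σ _ hσ]; simp [uvec0, uvec1, uvecs]

lemma w_sum (n : ℕ) : ∑ i : Fin (n+1), wvec n i.succ.succ = -1 := by
  rw [Fin.sum_univ_succ]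
  have h1 : wvec n (Fin.succ (Fin.succ 0)) = -1 := rfl
  have h2 : ∀ i : Fin n, wvec n i.succ.succ.succ = 0 := fun _ => rfl
  rw [h1, Finset.sum_congr rfl (fun i _ => h2 i)]
  simp

lemma w_mem (n : ℕ) (σ : Fin (n + 2 + 1) → ℤ)
    (hσ : ∀ i, σ i = if (i : ℕ) ≤ 1 then 1 else 2) : wvec n ∈ orthComp (n+2) σ := by
  rw [mem_orth' n σ _ hσ, w_sum]; simp [wvec0, wvec1]

lemma u_dot (n : ℕ) (x : Fin (n+2+1) → ℤ) : ∑ i, uvec n i * x i = x 0 - x 1 := by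
  rw [sum_split]; simp [uvec0, uvec1, uvecs]; ring

lemma part1 (n : ℕ) (σ : Fin (n + 2 + 1) → ℤ)
    (hσ : ∀ i, σ i = if (i : ℕ) ≤ 1 then 1 else 2) :
    ∃ S₁ S₂ : Submodule ℤ (Fin (n + 2 + 1) → ℤ),
      S₁ ≠ ⊥ ∧ S₂ ≠ ⊥ ∧ S₁ ≤ orthComp (n+2) σ ∧ S₂ ≤ orthComp (n+2) σ ∧
      S₁ ⊓ S₂ = ⊥ ∧ S₁ ⊔ S₂ = orthComp (n+2) σ ∧
      ∀ x ∈ S₁, ∀ y ∈ S₂, -(∑ i, x i * y i) = 0 := by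
  let T : Submodule ℤ (Fin (n + 2 + 1) → ℤ) :=
    LinearMap.ker ((LinearMap.proj 0 : (Fin (n + 2 + 1) → ℤ) →ₗ[ℤ] ℤ) - LinearMap.proj 1)
  have hT : ∀ x, x ∈ T ↔ x 0 = x 1 := by
    intro x; simp [T, LinearMap.mem_ker, sub_eq_zero]
  have hU : Submodule.span ℤ {uvec n} ≤ orthComp (n+2) σ := by
    rw [Submodule.span_singleton_le_iff_mem]; exact u_mem n σ hσ
  refine ⟨Submodule.span ℤ {uvec n}, orthComp (n+2) σ ⊓ T, ?_, ?_, hU, inf_le_left, ?_, ?_, ?_⟩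
  · rw [Ne, Submodule.span_singleton_eq_bot]
    intro h
    have := congrFun h 0
    simp [uvec0] at this
  · rw [Submodule.ne_bot_iff]
    refine ⟨wvec n, ⟨w_mem n σ hσ, (hT _).2 rfl⟩, ?_⟩
    intro h
    have := congrFun h 0
    simp [wvec0] at this
  · rw [eq_bot_iff]
    rintro x ⟨hx1, _, hx2⟩
    obtain ⟨a, rfl⟩ := Submodule.mem_span_singleton.1 hx1
    have := (hT _).1 hx2
    simp [uvec0, uvec1] at this
    have : a = 0 := by omega
    simp [this]
  · apply le_antisymm (sup_le hU inf_le_left)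
    intro x hx
    have hx' := (mem_orth' n σ x hσ).1 hx
    set s := ∑ i : Fin (n+1), x i.succ.succ
    have hx2 : x - (x 0 + s) • uvec n ∈ orthComp (n+2) σ :=
      Submodule.sub_mem _ hx (Submodule.smul_mem _ _ (u_mem n σ hσ))
    refine Submodule.mem_sup.2 ⟨(x 0 + s) • uvec n,
      Submodule.smul_mem _ _ (Submodule.mem_span_singleton_self _), _, ⟨hx2, (hT _).2 ?_⟩,
      add_sub_cancel _ _⟩
    simp [uvec0, uvec1]
    linarith
  · rintro x hx y ⟨_, hy⟩
    obtain ⟨a, rfl⟩ := Submodule.mem_span_singleton.1 hx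
    have := (hT _).1 hy
    simp only [Pi.smul_apply, smul_eq_mul, mul_assoc]
    rw [← Finset.mul_sum, u_dot, this]; simp

lemma tri_sum (m : ℕ) (d c : Fin m → ℤ) (C D : ℕ → ℤ) (h0 : C 0 = 0) (hm : C (m+1) = 0)
    (hC : ∀ i : Fin m, C (i+1) = c i) (hD : ∀ i : Fin m, D i = - d i) (i : Fin m) :
    ∑ j, c j * (- triM m d j i) = D i * C (i+1) - C i - C (i+2) := by
  have h : ∀ j : Fin m, c j * (- triM m d j i) =
      (fun j : ℕ => (if j = (i:ℕ) then D i * C (j+1) else 0)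
        - (if j + 1 = (i:ℕ) then C (j+1) else 0)
        - (if j = (i:ℕ) + 1 then C (j+1) else 0)) (j : ℕ) := by
    intro j
    simp only [triM]
    by_cases h1 : j = i
    · subst h1
      simp [hC, hD]; ring
    · have h1' : (j : ℕ) ≠ i := fun h => h1 (Fin.ext h)
      simp only [h1, h1', if_false]
      by_cases h2 : (j : ℕ) + 1 = i
      · rw [if_pos (by right; omega), if_pos h2, if_neg (by omega), hC]; ring
      · by_cases h3 : (j : ℕ) = i + 1
        · rw [if_pos (by left; omega), if_neg h2, if_pos h3, hC]; ring
        · rw [if_neg (by omega), if_neg h2, if_neg h3]; ring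
  rw [Finset.sum_congr rfl (fun j _ => h j), Fin.sum_univ_eq_sum_range (fun j : ℕ =>
        (if j = (i:ℕ) then D i * C (j+1) else 0)
        - (if j + 1 = (i:ℕ) then C (j+1) else 0)
        - (if j = (i:ℕ) + 1 then C (j+1) else 0)),
    Finset.sum_sub_distrib, Finset.sum_sub_distrib]
  have hi := i.2
  congr 1
  · congr 1
    · rw [Finset.sum_ite_eq' (Finset.range m) (i:ℕ) (fun j => D i * C (j+1))]
      simp
    · rcases Nat.eq_zero_or_pos (i:ℕ) with hz | hz
      · rw [hz, h0]; simp
      · rw [Finset.sum_eq_single ((i:ℕ)-1)]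
        · rw [if_pos (by omega)]; congr 1; omega
        · intro b _ hb; rw [if_neg (by omega)]
        · intro hb; simp at hb; omega
  · rw [Finset.sum_ite_eq' (Finset.range m) ((i:ℕ)+1) (fun j => C (j+1))]
    split_ifs with hh
    · rfl
    · have : (i:ℕ) + 2 = m + 1 := by simp at hh; omega
      rw [this, hm]

lemma part2 (n : ℕ) (σ : Fin (n + 2 + 1) → ℤ)
    (hσ : ∀ i, σ i = if (i : ℕ) ≤ 1 then 1 else 2) :
    ¬ ∃ (m : ℕ) (d : Fin m → ℤ) (v : Fin m → (Fin (n + 2 + 1) → ℤ)),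
        (∀ i, d i ≤ -2) ∧ LinearIndependent ℤ v ∧
        Submodule.span ℤ (Set.range v) = orthComp (n+2) σ ∧
        ∀ i j, -(∑ l, v i l * v j l) = triM m d i j := by
  rintro ⟨m, d, v, hd, -, hspan, hG⟩
  have hu := u_mem n σ hσ
  have hw := w_mem n σ hσ
  rw [← hspan, Submodule.mem_span_range_iff_exists_fun] at hu hw
  obtain ⟨c, hc⟩ := hu
  obtain ⟨b, hb⟩ := hw
  let C : ℕ → ℤ := fun k => if h : 1 ≤ k ∧ k ≤ m then c ⟨k - 1, by omega⟩ else 0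
  let D : ℕ → ℤ := fun k => if h : k < m then - d ⟨k, h⟩ else 2
  have h0 : C 0 = 0 := by simp [C]
  have hm : C (m+1) = 0 := by simp [C]
  have hC : ∀ i : Fin m, C (i+1) = c i := by
    intro i
    have := i.2
    simp only [C]
    rw [dif_pos ⟨by omega, by omega⟩]
    rfl
  have hD : ∀ i : Fin m, D i = - d i := by
    intro i; simp [D]
  have hdot : ∀ i : Fin m, D i * C (i+1) - C i - C (i+2) = v i 0 - v i 1 := by
    intro i
    rw [← tri_sum m d c C D h0 hm hC hD i, ← u_dot, ← hc]
    simp only [Finset.sum_apply, Pi.smul_apply, smul_eq_mul, Finset.sum_mul, ← hG, neg_neg,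
      Finset.mul_sum]
    rw [Finset.sum_comm]
    simp only [mul_assoc]
  have hm1 : m = 1 := by
    apply key m C D h0 hm
    · intro k hk
      have := hD ⟨k, hk⟩
      have h2 := hd ⟨k, hk⟩
      simp only at this
      omega
    · intro k hk
      have := hdot ⟨k, hk⟩
      simp only at this
      rw [this]
      have hv : v ⟨k, hk⟩ ∈ orthComp (n+2) σ := by
        rw [← hspan]; exact Submodule.subset_span ⟨_, rfl⟩
      rw [mem_orth' n σ _ hσ] at hv
      rw [Int.even_iff]
      omega
    · rw [← Fin.sum_univ_eq_sum_range
        (fun k => C (k+1) * (D k * C (k+1) - C k - C (k+2)))]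
      have : ∀ i : Fin m, C (i+1) * (D i * C (i+1) - C i - C (i+2))
          = c i * v i 0 - c i * v i 1 := by
        intro i; rw [hdot, hC]; ring
      rw [Finset.sum_congr rfl (fun i _ => this i), Finset.sum_sub_distrib]
      have e0 := congrFun hc 0
      have e1 := congrFun hc 1
      simp only [Finset.sum_apply, Pi.smul_apply, smul_eq_mul, uvec0, uvec1] at e0 e1
      rw [e0, e1]; norm_num
  subst hm1
  simp only [Fin.sum_univ_one] at hc hb
  have e0 := congrFun hc 0
  have e1 := congrFun hc 1
  have f0 := congrFun hb 0
  have f1 := congrFun hb 1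
  simp only [Pi.smul_apply, smul_eq_mul, uvec0, uvec1, wvec0, wvec1] at e0 e1 f0 f1
  have k1 : c 0 * (b 0 * v 0 1) = b 0 * (c 0 * v 0 1) := by ring
  have k0 : c 0 * (b 0 * v 0 0) = b 0 * (c 0 * v 0 0) := by ring
  rw [e1, f1] at k1
  rw [e0, f0] at k0
  have : c 0 = 0 := by omega
  rw [this] at e0
  simp at e0

theorem stmt_14 (n : ℕ) (hn : 2 ≤ n) (σ : Fin (n + 1) → ℤ)
    (hσ : ∀ i, σ i = if (i : ℕ) ≤ 1 then 1 else 2) :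
    (∃ S₁ S₂ : Submodule ℤ (Fin (n + 1) → ℤ),
      S₁ ≠ ⊥ ∧ S₂ ≠ ⊥ ∧ S₁ ≤ orthComp n σ ∧ S₂ ≤ orthComp n σ ∧
      S₁ ⊓ S₂ = ⊥ ∧ S₁ ⊔ S₂ = orthComp n σ ∧
      ∀ x ∈ S₁, ∀ y ∈ S₂, -(∑ i, x i * y i) = 0) ∧
    ¬ ∃ (m : ℕ) (d : Fin m → ℤ) (v : Fin m → (Fin (n + 1) → ℤ)),
        (∀ i, d i ≤ -2) ∧ LinearIndependent ℤ v ∧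
        Submodule.span ℤ (Set.range v) = orthComp n σ ∧
        ∀ i j, -(∑ l, v i l * v j l) = triM m d i j := by
  obtain ⟨k, rfl⟩ : ∃ k, n = k + 2 := ⟨n - 2, by omega⟩
  exact ⟨part1 k σ hσ, part2 k σ hσ⟩
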